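/- arXiv:1703.09426 — 2 statements merged into one kernel-verified Lean document; each statement's English description precedes it below -/
import Mathlib

section
/- Let f : ℝⁿ → ℝ be convex and continuous with nonempty sublevel set S(f,0), let g_f be a subgradient selection of f and P_f the associated subgradient projection. Then for every bounded sequence {y^k} ⊆ ℝⁿ the following are equivalent: (a) f₊(y^k) → 0; (b) ‖P_f y^k − y^k‖ → 0; (c) d(y^k, S(f,0)) → 0. -/
open Filter Metric RealInnerProductSpace

/-- The subgradient projection associated with `f` and a subgradient selection `g`. -/
noncomputable def subgradProj {E : Type*} [NormedAddCommGroup E] [InnerProductSpace ℝ E]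
    (f : E → ℝ) (g : E → E) : E → E := fun x =>
  if 0 < f x then x - (f x / ‖g x‖ ^ 2) • g x else x

/-- For a convex continuous `f : ℝⁿ → ℝ` with nonempty sublevel set and
a subgradient selection `g`, along every bounded sequence the conditions
`f₊(y^k) → 0`, `‖P_f y^k − y^k‖ → 0` and `d(y^k, S(f,0)) → 0` are equivalent. -/
theorem subgradProj_residual_equivalences
    {n : ℕ} (f : EuclideanSpace ℝ (Fin n) → ℝ)
    (g : EuclideanSpace ℝ (Fin n) → EuclideanSpace ℝ (Fin n))
    (hconv : ConvexOn ℝ Set.univ f) (hcont : Continuous f)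
    (hsub : ∀ x y : EuclideanSpace ℝ (Fin n), f x + ⟪g x, y - x⟫ ≤ f y)
    (hne : ∃ z : EuclideanSpace ℝ (Fin n), f z ≤ 0) :
    ∀ y : ℕ → EuclideanSpace ℝ (Fin n), Bornology.IsBounded (Set.range y) →
      ((Tendsto (fun k => max 0 (f (y k))) atTop (nhds 0) ↔
        Tendsto (fun k => ‖subgradProj f g (y k) - y k‖) atTop (nhds 0)) ∧
      (Tendsto (fun k => ‖subgradProj f g (y k) - y k‖) atTop (nhds 0) ↔
        Tendsto (fun k => infDist (y k) {z : EuclideanSpace ℝ (Fin n) | f z ≤ 0})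
          atTop (nhds 0))) := by
  intro y hy
  obtain ⟨z0, hz0⟩ := hne
  set S := {z : EuclideanSpace ℝ (Fin n) | f z ≤ 0} with hS
  have hSne : S.Nonempty := ⟨z0, hz0⟩
  have hScl : IsClosed S := isClosed_le hcont continuous_const
  obtain ⟨R, hR⟩ := hy.subset_closedBall 0
  have hyR : ∀ k, y k ∈ closedBall (0 : EuclideanSpace ℝ (Fin n)) R := fun k => hR ⟨k, rfl⟩
  -- key inequality
  have key : ∀ x z, f z ≤ 0 → f x ≤ ‖g x‖ * dist x z := by
    intro x z hz
    have h1 := hsub x z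
    have h2 := abs_real_inner_le_norm (g x) (z - x)
    have h3 := neg_abs_le (⟪g x, z - x⟫)
    rw [dist_comm, dist_eq_norm]
    linarith
  have gpos : ∀ x, 0 < f x → 0 < ‖g x‖ := by
    intro x hx
    have h := key x z0 hz0
    rcases (norm_nonneg (g x)).eq_or_lt with h0 | h0
    · rw [← h0] at h
      linarith
    · exact h0
  have res : ∀ x, 0 < f x → ‖subgradProj f g x - x‖ = f x / ‖g x‖ := by
    intro x hx
    have hg := gpos x hx
    have : subgradProj f g x - x = -((f x / ‖g x‖ ^ 2) • g x) := by
      simp [subgradProj, hx]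
    rw [this, norm_neg, norm_smul, Real.norm_of_nonneg (by positivity)]
    field_simp
  have res0 : ∀ x, ¬ 0 < f x → ‖subgradProj f g x - x‖ = 0 := by
    intro x hx
    simp [subgradProj, hx]
  have cb : Tendsto (fun k => infDist (y k) S) atTop (nhds 0) →
      Tendsto (fun k => ‖subgradProj f g (y k) - y k‖) atTop (nhds 0) := by
    intro h
    refine squeeze_zero (fun _ => norm_nonneg _) (fun k => ?_) h
    by_cases hx : 0 < f (y k)
    · rw [res _ hx, le_infDist hSne]
      intro z hz
      rw [div_le_iff₀ (gpos _ hx), mul_comm]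
      exact key _ z hz
    · rw [res0 _ hx]
      exact infDist_nonneg
  have ba : Tendsto (fun k => ‖subgradProj f g (y k) - y k‖) atTop (nhds 0) →
      Tendsto (fun k => max 0 (f (y k))) atTop (nhds 0) := by
    intro h
    obtain ⟨C, hC⟩ := (isCompact_closedBall (0 : EuclideanSpace ℝ (Fin n))
      (R + 1)).exists_bound_of_continuousOn hcont.continuousOn
    have hM : ∀ k, 0 < f (y k) → ‖g (y k)‖ ≤ 2 * C := by
      intro k hk
      have hg := gpos _ hk
      have hyk := hyR k
      rw [mem_closedBall_zero_iff] at hyk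
      have hu : ‖‖g (y k)‖⁻¹ • g (y k)‖ = 1 := by
        rw [norm_smul, norm_inv, norm_norm, inv_mul_cancel₀ hg.ne']
      have h1 := hC (y k) (by rw [mem_closedBall_zero_iff]; linarith)
      have h2 := hC (y k + ‖g (y k)‖⁻¹ • g (y k)) (by
        rw [mem_closedBall_zero_iff]
        exact (norm_add_le _ _).trans (by linarith))
      have h3 := hsub (y k) (y k + ‖g (y k)‖⁻¹ • g (y k))
      have h4 : ⟪g (y k), y k + ‖g (y k)‖⁻¹ • g (y k) - y k⟫ = ‖g (y k)‖ := by
        rw [add_sub_cancel_left, real_inner_smul_right, real_inner_self_eq_norm_sq]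
        field_simp
      rw [h4] at h3
      rw [Real.norm_eq_abs, abs_le] at h1 h2
      linarith
    have hlim := h.const_mul (2 * C)
    rw [mul_zero] at hlim
    refine squeeze_zero (fun _ => le_max_left _ _) (fun k => ?_) hlim
    by_cases hx : 0 < f (y k)
    · have hg := gpos _ hx
      rw [max_eq_right hx.le, res _ hx]
      calc f (y k) = ‖g (y k)‖ * (f (y k) / ‖g (y k)‖) := by field_simp
        _ ≤ _ := mul_le_mul_of_nonneg_right (hM k hx) (by positivity)
    · rw [max_eq_left (not_lt.mp hx), res0 _ hx, mul_zero]
  have ac : Tendsto (fun k => max 0 (f (y k))) atTop (nhds 0) →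
      Tendsto (fun k => infDist (y k) S) atTop (nhds 0) := by
    intro h
    rw [tendsto_order]
    refine ⟨fun a ha => Eventually.of_forall fun k => ha.trans_le infDist_nonneg, ?_⟩
    intro ε hε
    have hK : IsCompact (closedBall (0 : EuclideanSpace ℝ (Fin n)) R ∩ {x | ε ≤ infDist x S}) :=
      (isCompact_closedBall _ _).inter_right
        (isClosed_le continuous_const (continuous_infDist_pt S))
    rcases Set.eq_empty_or_nonempty
      (closedBall (0 : EuclideanSpace ℝ (Fin n)) R ∩ {x | ε ≤ infDist x S}) with he | hne
    · refine Eventually.of_forall fun k => ?_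
      by_contra hc
      have : y k ∈ closedBall (0 : EuclideanSpace ℝ (Fin n)) R ∩ {x | ε ≤ infDist x S} :=
        ⟨hyR k, not_lt.mp hc⟩
      rw [he] at this
      exact this
    · obtain ⟨m, hm, hmin⟩ := hK.exists_isMinOn hne hcont.continuousOn
      have hfm : 0 < f m := by
        by_contra hc
        have hmS : m ∈ S := not_lt.mp hc
        have h1 : ε ≤ infDist m S := hm.2
        rw [infDist_zero_of_mem hmS] at h1
        linarith
      filter_upwards [h.eventually (gt_mem_nhds hfm)] with k hk
      by_contra hc
      have h2 : f m ≤ f (y k) := hmin ⟨hyR k, not_lt.mp hc⟩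
      have := le_max_right 0 (f (y k))
      linarith
  exact ⟨⟨fun h => cb (ac h), ba⟩, ⟨fun h => ac (ba h), cb⟩⟩
end

section
/- For each i ∈ I = {1,…,m}, let f_i : ℝⁿ → ℝ be convex and continuous with C := ⋂_{i∈I} S(f_i, 0) ≠ ∅, and suppose for each i there is z^i with f_i(z^i) < 0. Let {x^k} be generated by the double-layer subgradient projection algorithm x^{k+1} := x^k + α_k(Σ_{i∈I_k} ω_i^k P_{f_i} x^k − x^k) under conditions (i) and (ii), and assume (iii): I_k ∩ Argmax_{j∈J_k} f_j⁺(x^k) ≠ ∅ for every k. Then for r := d(x^0, C) > 0 there exist δ_r, Δ_r > 0 such that δ_r d(x, S(f_i,0)) ≤ f_i⁺(x) ≤ Δ_r ‖P_{f_i} x − x‖ for every x ∈ B(P_C x^0, r) and i ∈ I; and if in addition the family {S(f_i,0) : i ∈ I} is κ_r-linearly regular over B(P_C x^0, r), then {x^k} converges linearly to some x^∞ ∈ C: ‖x^k − x^∞‖ ≤ c_r q_r^k with q_r := (1 − (ω⁻(2−α⁺)(α⁻)²/(s α⁺)) · (δ_r/(Δ_r κ_r))²)^{1/(2s)} and c_r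 := 2 d(x^0, C)/q_r^{s−1}, and the error bound (δ_r/(2κ_r)) ‖x^k − x^∞‖ ≤ max_{i∈I} f_i⁺(x^k) ≤ Δ_r c_r q_r^k holds for every k. -/
open Filter Metric Bornology RealInnerProductSpace

theorem aux_jensen {E : Type*} [NormedAddCommGroup E] {ι : Type*} (I : Finset ι)
    (w : ι → ℝ) (v : ι → E) (hw : ∀ i ∈ I, 0 ≤ w i) (hsum : ∑ i ∈ I, w i = 1) :
    (∑ i ∈ I, w i * ‖v i‖) ^ 2 ≤ ∑ i ∈ I, w i * ‖v i‖ ^ 2 :=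
  Real.pow_arith_mean_le_arith_mean_pow I w (fun i => ‖v i‖) hw hsum (fun _ _ => norm_nonneg _) 2

theorem aux_cs (l : ℕ) (u v A B : ℝ) (hA : 0 ≤ A) (hu : u ^ 2 ≤ l * A) (hv : v ^ 2 ≤ B) :
    (u + v) ^ 2 ≤ (l + 1 : ℝ) * (A + B) := by
  have hl : (0 : ℝ) ≤ l := Nat.cast_nonneg l
  have hB : 0 ≤ B := (sq_nonneg v).trans hv
  have h1 : |u * v| ≤ |(A + l * B) / 2| := by
    rw [← sq_le_sq]
    have : (u * v) ^ 2 ≤ (l * A) * B := by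
      rw [mul_pow]; gcongr
    nlinarith [sq_nonneg (A - l * B)]
  rw [abs_of_nonneg (by positivity : 0 ≤ (A + l * B) / 2)] at h1
  have := le_abs_self (u * v)
  nlinarith

section Helpers

variable {E : Type*} [NormedAddCommGroup E] [InnerProductSpace ℝ E]

theorem aux_grad_ne (f : E → ℝ) (g : E → E)
    (hsub : ∀ y z : E, f y + ⟪g y, z - y⟫ ≤ f z) (x z : E) (hz : f z ≤ 0) (hx : 0 < f x) :
    0 < ‖g x‖ := by
  rw [norm_pos_iff]
  intro h
  have := hsub x z
  rw [h, inner_zero_left] at this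
  linarith

theorem aux_inner (f : E → ℝ) (g : E → E)
    (hsub : ∀ y z : E, f y + ⟪g y, z - y⟫ ≤ f z) (x z : E) (hz : f z ≤ 0) :
    ⟪x - z, subgradProj f g x - x⟫ ≤ - ‖subgradProj f g x - x‖ ^ 2 := by
  unfold subgradProj
  split_ifs with hx
  · have hg := aux_grad_ne f g hsub x z hz hx
    have h1 := hsub x z
    have h2 : ⟪g x, z - x⟫ = - ⟪x - z, g x⟫ := by
      rw [real_inner_comm, ← neg_sub x z, inner_neg_left]
    have e : x - (f x / ‖g x‖ ^ 2) • g x - x = - ((f x / ‖g x‖ ^ 2) • g x) := by abel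
    rw [e, inner_neg_right, norm_neg, inner_smul_right, norm_smul, Real.norm_eq_abs, mul_pow, sq_abs]
    have h3 : (f x / ‖g x‖ ^ 2) ^ 2 * ‖g x‖ ^ 2 = f x / ‖g x‖ ^ 2 * f x := by
      field_simp
    rw [h3]
    have : f x / ‖g x‖ ^ 2 * f x ≤ f x / ‖g x‖ ^ 2 * ⟪x - z, g x⟫ := by
      apply mul_le_mul_of_nonneg_left _ (by positivity)
      linarith
    linarith
  · simp

theorem aux_norm_le (f : E → ℝ) (g : E → E)
    (hsub : ∀ y z : E, f y + ⟪g y, z - y⟫ ≤ f z) (x z : E) (hz : f z ≤ 0) :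
    ‖subgradProj f g x - x‖ ≤ ‖x - z‖ := by
  have h := aux_inner f g hsub x z hz
  have h2 := abs_real_inner_le_norm (x - z) (subgradProj f g x - x)
  have h3 := neg_abs_le (⟪x - z, subgradProj f g x - x⟫)
  by_contra! hlt
  have := norm_nonneg (x - z)
  nlinarith [norm_nonneg (subgradProj f g x - x)]

theorem aux_fplus (f : E → ℝ) (g : E → E)
    (hsub : ∀ y z : E, f y + ⟪g y, z - y⟫ ≤ f z) (x z : E) (hz : f z ≤ 0)
    (Δ : ℝ) (hΔ : ‖g x‖ ≤ Δ) :
    max 0 (f x) ≤ Δ * ‖subgradProj f g x - x‖ := by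
  have hΔ0 : 0 ≤ Δ := (norm_nonneg _).trans hΔ
  apply max_le (by positivity)
  by_cases hx : 0 < f x
  · have hg := aux_grad_ne f g hsub x z hz hx
    have e : ‖subgradProj f g x - x‖ = f x / ‖g x‖ := by
      unfold subgradProj
      rw [if_pos hx]
      have e : x - (f x / ‖g x‖ ^ 2) • g x - x = - ((f x / ‖g x‖ ^ 2) • g x) := by abel
      rw [e, norm_neg, norm_smul, Real.norm_eq_abs, abs_of_pos (by positivity)]
      field_simp
    rw [e]
    calc f x = ‖g x‖ * (f x / ‖g x‖) := by field_simp
      _ ≤ _ := by gcongr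
  · push Not at hx
    exact hx.trans (by positivity)

theorem aux_step {ι : Type*} (I : Finset ι) (w : ι → ℝ) (v : ι → E) (hw : ∀ i ∈ I, 0 ≤ w i)
    (hsum : ∑ i ∈ I, w i = 1) (a : ℝ) (ha : 0 ≤ a) (x z : E)
    (hv : ∀ i ∈ I, ⟪x - z, v i⟫ ≤ - ‖v i‖ ^ 2) :
    ‖∑ i ∈ I, w i • v i‖ ^ 2 ≤ ∑ i ∈ I, w i * ‖v i‖ ^ 2 ∧
    ‖x + a • (∑ i ∈ I, w i • v i) - z‖ ^ 2 ≤ ‖x - z‖ ^ 2 - 2 * a * (∑ i ∈ I, w i * ‖v i‖ ^ 2)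
      + a ^ 2 * ‖∑ i ∈ I, w i • v i‖ ^ 2 := by
  constructor
  · have h1 : ‖∑ i ∈ I, w i • v i‖ ≤ ∑ i ∈ I, w i * ‖v i‖ := by
      refine (norm_sum_le _ _).trans (Finset.sum_le_sum fun i hi => ?_)
      rw [norm_smul, Real.norm_eq_abs, abs_of_nonneg (hw i hi)]
    calc _ ≤ (∑ i ∈ I, w i * ‖v i‖) ^ 2 := by gcongr
      _ ≤ _ := aux_jensen I w v hw hsum
  · have e : x + a • (∑ i ∈ I, w i • v i) - z = (x - z) + a • (∑ i ∈ I, w i • v i) := by abel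
    rw [e, norm_add_sq_real, inner_smul_right, norm_smul, mul_pow, Real.norm_eq_abs, sq_abs, inner_sum]
    have : ∑ i ∈ I, ⟪x - z, w i • v i⟫ ≤ - ∑ i ∈ I, w i * ‖v i‖ ^ 2 := by
      rw [← Finset.sum_neg_distrib]
      refine Finset.sum_le_sum fun i hi => ?_
      rw [inner_smul_right]
      have := mul_le_mul_of_nonneg_left (hv i hi) (hw i hi)
      linarith
    have := mul_le_mul_of_nonneg_left this ha
    linarith

/-- Block decrease, abstract. -/
theorem aux_block (x : ℕ → E) (z : E) (K : ℝ) (hK : 0 ≤ K) (k : ℕ)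
    (hstep : ∀ k, ‖x (k + 1) - x k‖ ^ 2 ≤ K * (‖x k - z‖ ^ 2 - ‖x (k + 1) - z‖ ^ 2))
    (l : ℕ) (b : ℝ)
    (hb : b ^ 2 ≤ K * (‖x (k + l) - z‖ ^ 2 - ‖x (k + l + 1) - z‖ ^ 2)) :
    (‖x k - x (k + l)‖ + b) ^ 2 ≤
      (l + 1 : ℝ) * K * (‖x k - z‖ ^ 2 - ‖x (k + l + 1) - z‖ ^ 2) := by
  have h1 : ∀ l, ‖x k - x (k + l)‖ ^ 2 ≤ l * K * (‖x k - z‖ ^ 2 - ‖x (k + l) - z‖ ^ 2) ∧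
      0 ≤ K * (‖x k - z‖ ^ 2 - ‖x (k + l) - z‖ ^ 2) := by
    intro l
    induction l with
    | zero => simp
    | succ l ih =>
      obtain ⟨ih1, ih2⟩ := ih
      have hs := hstep (k + l)
      have ht : ‖x k - x (k + (l + 1))‖ ≤ ‖x k - x (k + l)‖ + ‖x (k + l + 1) - x (k + l)‖ := by
        rw [norm_sub_rev (x (k + l + 1))]
        exact norm_sub_le_norm_sub_add_norm_sub _ _ _
      have e : k + (l + 1) = k + l + 1 := rfl
      rw [e] at *
      refine ⟨?_, by nlinarith [sq_nonneg ‖x (k + l + 1) - x (k + l)‖]⟩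
      calc _ ≤ (‖x k - x (k + l)‖ + ‖x (k + l + 1) - x (k + l)‖) ^ 2 :=
            pow_le_pow_left₀ (norm_nonneg _) ht 2
        _ ≤ (l + 1) * (K * (‖x k - z‖ ^ 2 - ‖x (k + l) - z‖ ^ 2) +
            K * (‖x (k + l) - z‖ ^ 2 - ‖x (k + l + 1) - z‖ ^ 2)) :=
          aux_cs l _ _ _ _ ih2 (by linarith) hs
        _ = _ := by push_cast; ring
  obtain ⟨a1, a2⟩ := h1 l
  calc _ ≤ (l + 1) * (K * (‖x k - z‖ ^ 2 - ‖x (k + l) - z‖ ^ 2) +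
            K * (‖x (k + l) - z‖ ^ 2 - ‖x (k + l + 1) - z‖ ^ 2)) :=
          aux_cs l _ _ _ _ a2 (by linarith) hb
    _ = _ := by ring

theorem aux_grad_bdd [ProperSpace E] (f : E → ℝ) (g : E → E) (hcont : Continuous f)
    (hsub : ∀ y z : E, f y + ⟪g y, z - y⟫ ≤ f z) (c : E) (r : ℝ) :
    ∃ M : ℝ, ∀ y ∈ closedBall c r, ‖g y‖ ≤ M := by
  obtain ⟨M, hM⟩ := (isCompact_closedBall c (r + 1)).exists_bound_of_continuousOn hcont.continuousOn
  refine ⟨2 * M, fun y hy => ?_⟩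
  have h0 : f y ∈ Set.Icc (-M) M := abs_le.mp (hM y (closedBall_subset_closedBall (by linarith) hy))
  by_cases hg : g y = 0
  · rw [hg, norm_zero]; linarith [h0.1, h0.2]
  have hg' : 0 < ‖g y‖ := norm_pos_iff.mpr hg
  have hu : ‖(‖g y‖⁻¹) • g y‖ = 1 := by
    rw [norm_smul, norm_inv, norm_norm]; field_simp
  have h1 : f (y + (‖g y‖⁻¹) • g y) ∈ Set.Icc (-M) M := by
    apply abs_le.mp (hM _ _)
    rw [mem_closedBall, dist_eq_norm] at *
    calc _ = ‖(y - c) + (‖g y‖⁻¹) • g y‖ := by congr 1; abel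
      _ ≤ _ := norm_add_le _ _
      _ ≤ _ := by linarith
  have h2 := hsub y (y + (‖g y‖⁻¹) • g y)
  rw [add_sub_cancel_left, inner_smul_right, real_inner_self_eq_norm_sq] at h2
  have h3 : ‖g y‖⁻¹ * ‖g y‖ ^ 2 = ‖g y‖ := by field_simp
  rw [h3] at h2
  linarith [h0.1, h1.2]

theorem aux_slater (f : E → ℝ) (hconv : ConvexOn ℝ Set.univ f)
    (hS : ∃ z, f z < 0) (c : E) (r : ℝ) (hr : 0 < r) :
    ∃ δ : ℝ, 0 < δ ∧ ∀ y ∈ closedBall c r, δ * infDist y {z | f z ≤ 0} ≤ max 0 (f y) := by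
  obtain ⟨z, hz⟩ := hS
  have hR : 0 < ‖z - c‖ + r := by positivity
  refine ⟨-f z / (‖z - c‖ + r), div_pos (by linarith) hR, fun y hy => ?_⟩
  by_cases hy0 : f y ≤ 0
  · rw [infDist_zero_of_mem (show y ∈ {z | f z ≤ 0} from hy0)]; simp
  push Not at hy0
  rw [max_eq_right hy0.le]
  have hd : 0 < f y - f z := by linarith
  set t := f y / (f y - f z) with ht
  have ht0 : 0 ≤ t := by positivity
  have ht1 : t ≤ 1 := by rw [ht, div_le_one hd]; linarith
  have hmem : f ((1 - t) • y + t • z) ≤ 0 := by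
    have := hconv.2 (Set.mem_univ y) (Set.mem_univ z) (sub_nonneg.mpr ht1) ht0 (by ring)
    refine this.trans (le_of_eq ?_)
    simp only [smul_eq_mul, ht]
    field_simp
    ring
  have h1 : infDist y {z | f z ≤ 0} ≤ t * ‖y - z‖ := by
    refine (infDist_le_dist_of_mem (show _ ∈ {z | f z ≤ 0} from hmem)).trans (le_of_eq ?_)
    rw [dist_eq_norm]
    have : y - ((1 - t) • y + t • z) = t • (y - z) := by module
    rw [this, norm_smul, Real.norm_eq_abs, abs_of_nonneg ht0]
  have h2 : ‖y - z‖ ≤ ‖z - c‖ + r := by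
    rw [mem_closedBall, dist_eq_norm] at hy
    have := norm_sub_le_norm_sub_add_norm_sub y c z
    rw [norm_sub_rev c z] at this
    linarith
  have h3 : -f z * t ≤ f y := by
    rw [ht, ← mul_div_assoc, div_le_iff₀ hd]
    nlinarith
  have h4 : infDist y {z | f z ≤ 0} ≤ t * (‖z - c‖ + r) := h1.trans (by gcongr)
  calc _ ≤ -f z / (‖z - c‖ + r) * (t * (‖z - c‖ + r)) := by
        apply mul_le_mul_of_nonneg_left h4
        exact div_nonneg (by linarith) hR.le
    _ = -f z * t := by field_simp
    _ ≤ _ := h3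

/-- Fejér monotone sequence with linear block decrease of the distance. -/
theorem aux_conv [ProperSpace E] (x : ℕ → E) (C : Set E) (hC : C.Nonempty) (hCc : IsClosed C)
    (hF : ∀ z ∈ C, ∀ k, ‖x (k + 1) - z‖ ≤ ‖x k - z‖)
    (q : ℝ) (hq0 : 0 < q) (hq1 : q < 1) (s : ℕ) (hs : 1 ≤ s)
    (hblock : ∀ k, infDist (x (k + s)) C ≤ q ^ s * infDist (x k) C) :
    ∃ xinf ∈ C, (∀ k, ‖x k - xinf‖ ≤ 2 * infDist (x k) C) ∧
      ∀ k, ‖x k - xinf‖ ≤ 2 * infDist (x 0) C / q ^ (s - 1) * q ^ k := by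
  have hanti : ∀ z ∈ C, Antitone fun k => ‖x k - z‖ := fun z hz => antitone_nat_of_succ_le (hF z hz)
  have hd : ∀ k l, k ≤ l → infDist (x l) C ≤ infDist (x k) C ∧
      ‖x k - x l‖ ≤ 2 * infDist (x k) C := by
    intro k l hkl
    obtain ⟨z, hz, hzd⟩ := hCc.exists_infDist_eq_dist hC (x k)
    have h1 : ‖x l - z‖ ≤ ‖x k - z‖ := hanti z hz hkl
    rw [dist_eq_norm] at hzd
    constructor
    · rw [hzd]
      exact (infDist_le_dist_of_mem hz).trans (by rwa [dist_eq_norm])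
    · rw [hzd]
      have := norm_sub_le_norm_sub_add_norm_sub (x k) z (x l)
      rw [norm_sub_rev z] at this
      linarith
  have hD : ∀ k, infDist (x k) C * q ^ (s - 1) ≤ infDist (x 0) C * q ^ k := by
    intro k
    induction k using Nat.strong_induction_on with
    | _ k ih =>
      by_cases hk : k < s
      · apply mul_le_mul (hd 0 k (Nat.zero_le _)).1 _ (by positivity) infDist_nonneg
        exact pow_le_pow_of_le_one hq0.le hq1.le (by omega)
      · obtain ⟨j, rfl⟩ : ∃ j, k = j + s := ⟨k - s, by omega⟩
        calc _ ≤ (q ^ s * infDist (x j) C) * q ^ (s - 1) := by gcongr; exact hblock j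
          _ = q ^ s * (infDist (x j) C * q ^ (s - 1)) := by ring
          _ ≤ q ^ s * (infDist (x 0) C * q ^ j) := 
            mul_le_mul_of_nonneg_left (ih j (by omega)) (by positivity)
          _ = _ := by ring
  have hD' : ∀ k, infDist (x k) C ≤ infDist (x 0) C / q ^ (s - 1) * q ^ k := by
    intro k
    rw [div_mul_eq_mul_div, le_div_iff₀ (by positivity)]
    exact hD k
  have hlim : Tendsto (fun k => infDist (x k) C) atTop (nhds 0) := by
    refine squeeze_zero (fun _ => infDist_nonneg) hD' ?_
    simpa using (tendsto_pow_atTop_nhds_zero_of_lt_one hq0.le hq1).const_mul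
      (infDist (x 0) C / q ^ (s - 1))
  have hcau : CauchySeq x := by
    refine cauchySeq_of_le_tendsto_0' (fun k => 2 * infDist (x k) C) (fun k l hkl => ?_) ?_
    · rw [dist_eq_norm]; exact (hd k l hkl).2
    · simpa using hlim.const_mul 2
  obtain ⟨xinf, hx⟩ := cauchySeq_tendsto_of_complete hcau
  have hb : ∀ k, ‖x k - xinf‖ ≤ 2 * infDist (x k) C := by
    intro k
    refine le_of_tendsto (tendsto_const_nhds.sub hx).norm ?_
    filter_upwards [eventually_ge_atTop k] with l hl using (hd k l hl).2
  refine ⟨xinf, ?_, hb, fun k => (hb k).trans ?_⟩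
  · rw [hCc.mem_iff_infDist_zero hC]
    exact tendsto_nhds_unique (((continuous_infDist_pt C).tendsto xinf).comp hx) hlim
  · have := hD' k
    calc _ ≤ 2 * (infDist (x 0) C / q ^ (s - 1) * q ^ k) := by linarith
      _ = _ := by ring

end Helpers

set_option maxHeartbeats 2000000 in
/-- Linear convergence with error bound of the double-layer subgradient
projection algorithm in ℝⁿ under the Slater condition for each `f_i`, the
most-violated-constraint control condition, and bounded linear regularity of the
family of sublevel sets. -/
theorem doubleLayer_subgradient_linear_convergence_Rn
    {n : ℕ} {m : ℕ} [NeZero m]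
    (f : Fin m → EuclideanSpace ℝ (Fin n) → ℝ)
    (g : Fin m → EuclideanSpace ℝ (Fin n) → EuclideanSpace ℝ (Fin n))
    (hconv : ∀ i, ConvexOn ℝ Set.univ (f i)) (hcont : ∀ i, Continuous (f i))
    (hsub : ∀ i, ∀ y z : EuclideanSpace ℝ (Fin n), f i y + ⟪g i y, z - y⟫ ≤ f i z)
    (hC : (⋂ i, {z : EuclideanSpace ℝ (Fin n) | f i z ≤ 0}).Nonempty)
    (hSlater : ∀ i, ∃ z : EuclideanSpace ℝ (Fin n), f i z < 0)
    (x : ℕ → EuclideanSpace ℝ (Fin n)) (Ik Jk : ℕ → Finset (Fin m))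
    (α : ℕ → ℝ) (ω : ℕ → Fin m → ℝ)
    (hIkne : ∀ k, (Ik k).Nonempty) (hIJ : ∀ k, Ik k ⊆ Jk k)
    (αminus αplus ωminus : ℝ)
    (hαminus : αminus ∈ Set.Ioc (0 : ℝ) 1) (hαplus : αplus ∈ Set.Ico (1 : ℝ) 2)
    (hωminus : ωminus ∈ Set.Ioc (0 : ℝ) 1)
    (hα : ∀ k, α k ∈ Set.Icc αminus αplus)
    (hω : ∀ k, ∀ i ∈ Ik k, ω k i ∈ Set.Icc ωminus 1)
    (hωsum : ∀ k, ∑ i ∈ Ik k, ω k i = 1)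
    (hrec : ∀ k, x (k + 1) =
      x k + α k • ((∑ i ∈ Ik k, ω k i • subgradProj (f i) (g i) (x k)) - x k))
    (s : ℕ) (hs : 1 ≤ s)
    (hcover : ∀ k, ∀ i : Fin m, ∃ l < s, i ∈ Jk (k + l))
    (hiii : ∀ k, ∃ i ∈ Ik k, ∀ j ∈ Jk k, max 0 (f j (x k)) ≤ max 0 (f i (x k)))
    (hr : 0 < infDist (x 0) (⋂ i, {z : EuclideanSpace ℝ (Fin n) | f i z ≤ 0}))
    (x0p : EuclideanSpace ℝ (Fin n))
    (hx0p : x0p ∈ ⋂ i, {z : EuclideanSpace ℝ (Fin n) | f i z ≤ 0})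
    (hx0pproj : ‖x 0 - x0p‖ =
      infDist (x 0) (⋂ i, {z : EuclideanSpace ℝ (Fin n) | f i z ≤ 0})) :
    ∃ δ : ℝ, 0 < δ ∧ ∃ Δ : ℝ, 0 < Δ ∧
      (∀ y ∈ closedBall x0p
          (infDist (x 0) (⋂ i, {z : EuclideanSpace ℝ (Fin n) | f i z ≤ 0})), ∀ i,
        δ * infDist y {z : EuclideanSpace ℝ (Fin n) | f i z ≤ 0} ≤ max 0 (f i y) ∧
        max 0 (f i y) ≤ Δ * ‖subgradProj (f i) (g i) y - y‖) ∧
      ∀ κ : ℝ, 0 < κ →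
        (∀ y ∈ closedBall x0p
            (infDist (x 0) (⋂ i, {z : EuclideanSpace ℝ (Fin n) | f i z ≤ 0})),
          infDist y (⋂ i, {z : EuclideanSpace ℝ (Fin n) | f i z ≤ 0}) ≤
            κ * Finset.univ.sup' Finset.univ_nonempty fun i =>
              infDist y {z : EuclideanSpace ℝ (Fin n) | f i z ≤ 0}) →
        ∃ xinf ∈ ⋂ i, {z : EuclideanSpace ℝ (Fin n) | f i z ≤ 0},
          (∀ k : ℕ, ‖x k - xinf‖ ≤
            2 * infDist (x 0) (⋂ i, {z : EuclideanSpace ℝ (Fin n) | f i z ≤ 0}) /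
                ((1 - ωminus * (2 - αplus) * αminus ^ 2 / ((s : ℝ) * αplus) *
                    (δ / (Δ * κ)) ^ 2) ^ ((1 : ℝ) / (2 * (s : ℝ)))) ^ (s - 1) *
              ((1 - ωminus * (2 - αplus) * αminus ^ 2 / ((s : ℝ) * αplus) *
                  (δ / (Δ * κ)) ^ 2) ^ ((1 : ℝ) / (2 * (s : ℝ)))) ^ k) ∧
          (∀ k : ℕ,
            δ / (2 * κ) * ‖x k - xinf‖ ≤
              (Finset.univ.sup' Finset.univ_nonempty fun i => max 0 (f i (x k))) ∧
            (Finset.univ.sup' Finset.univ_nonempty fun i => max 0 (f i (x k))) ≤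
              Δ * (2 * infDist (x 0)
                    (⋂ i, {z : EuclideanSpace ℝ (Fin n) | f i z ≤ 0}) /
                  ((1 - ωminus * (2 - αplus) * αminus ^ 2 / ((s : ℝ) * αplus) *
                      (δ / (Δ * κ)) ^ 2) ^ ((1 : ℝ) / (2 * (s : ℝ)))) ^ (s - 1)) *
                ((1 - ωminus * (2 - αplus) * αminus ^ 2 / ((s : ℝ) * αplus) *
                    (δ / (Δ * κ)) ^ 2) ^ ((1 : ℝ) / (2 * (s : ℝ)))) ^ k) := by
  set C : Set (EuclideanSpace ℝ (Fin n)) := ⋂ i, {z : EuclideanSpace ℝ (Fin n) | f i z ≤ 0}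
    with hCdef
  set r := infDist (x 0) C with hrdef
  have hmemC : ∀ z, z ∈ C ↔ ∀ i, f i z ≤ 0 := fun z => by simp [hCdef]
  have hCclosed : IsClosed C :=
    isClosed_iInter fun i => isClosed_le (hcont i) continuous_const
  have hz0 := (hmemC x0p).mp hx0p
  -- constants
  choose δf hδf hδf2 using fun i => aux_slater (f i) (hconv i) (hSlater i) x0p r hr
  choose Mf hMf using fun i => aux_grad_bdd (f i) (g i) (hcont i) (hsub i) x0p r
  obtain ⟨δ, hδ, hδle⟩ : ∃ δ : ℝ, 0 < δ ∧ ∀ i, δ ≤ δf i := by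
    refine ⟨Finset.univ.inf' Finset.univ_nonempty δf, ?_, fun i =>
      Finset.inf'_le _ (Finset.mem_univ i)⟩
    rw [Finset.lt_inf'_iff]
    exact fun i _ => hδf i
  obtain ⟨Δ, hΔ, hΔge⟩ : ∃ Δ : ℝ, 2 * δ ≤ Δ ∧ ∀ i, Mf i ≤ Δ :=
    ⟨max (2 * δ) (Finset.univ.sup' Finset.univ_nonempty Mf), le_max_left _ _, fun i =>
      (Finset.le_sup' Mf (Finset.mem_univ i)).trans (le_max_right _ _)⟩
  have hΔ0 : 0 < Δ := by linarith
  have hbd : ∀ y ∈ closedBall x0p r, ∀ i,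
      δ * infDist y {z : EuclideanSpace ℝ (Fin n) | f i z ≤ 0} ≤ max 0 (f i y) ∧
        max 0 (f i y) ≤ Δ * ‖subgradProj (f i) (g i) y - y‖ := by
    intro y hy i
    refine ⟨(mul_le_mul_of_nonneg_right (hδle i) infDist_nonneg).trans (hδf2 i y hy), ?_⟩
    exact aux_fplus (f i) (g i) (hsub i) y x0p (hz0 i) Δ ((hMf i y hy).trans (hΔge i))
  refine ⟨δ, hδ, Δ, hΔ0, hbd, fun κ hκ hreg => ?_⟩
  obtain ⟨ham0, ham1⟩ := hαminus
  obtain ⟨hap1, hap2⟩ := hαplus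
  obtain ⟨hw0, hw1⟩ := hωminus
  have hap0 : 0 < αplus := by linarith
  have h2a : 0 < 2 - αplus := by linarith
  have hs0 : (1 : ℝ) ≤ s := by exact_mod_cast hs
  have hs00 : (0 : ℝ) < s := by linarith
  -- the step
  set K : ℝ := αplus / (ωminus * (2 - αplus) * αminus ^ 2) with hKdef
  have hK0 : 0 < K := by positivity
  have hstep : ∀ z ∈ C, ∀ k,
      ‖x (k + 1) - x k‖ ^ 2 ≤ K * (‖x k - z‖ ^ 2 - ‖x (k + 1) - z‖ ^ 2) ∧
      ∀ j ∈ Ik k, ‖subgradProj (f j) (g j) (x k) - x k‖ ^ 2 ≤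
        K * (‖x k - z‖ ^ 2 - ‖x (k + 1) - z‖ ^ 2) := by
    intro z hz k
    obtain ⟨hak1, hak2⟩ := hα k
    have hak0 : 0 < α k := by linarith
    have hwk : ∀ i ∈ Ik k, 0 ≤ ω k i := fun i hi => hw0.le.trans (hω k i hi).1
    obtain ⟨hV, hA⟩ := aux_step (Ik k) (ω k) (fun i => subgradProj (f i) (g i) (x k) - x k)
      hwk (hωsum k) (α k) hak0.le (x k) z
      (fun i _ => aux_inner (f i) (g i) (hsub i) (x k) z ((hmemC z).mp hz i))
    have e : ∑ i ∈ Ik k, ω k i • (subgradProj (f i) (g i) (x k) - x k) =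
        (∑ i ∈ Ik k, ω k i • subgradProj (f i) (g i) (x k)) - x k := by
      simp only [smul_sub, Finset.sum_sub_distrib, ← Finset.sum_smul, hωsum k, one_smul]
    rw [e] at hV hA
    rw [← hrec k] at hA
    have e2 : x (k + 1) - x k =
        α k • ((∑ i ∈ Ik k, ω k i • subgradProj (f i) (g i) (x k)) - x k) := by
      rw [hrec k, add_sub_cancel_left]
    set V := ‖(∑ i ∈ Ik k, ω k i • subgradProj (f i) (g i) (x k)) - x k‖ ^ 2 with hVd
    set A := ∑ i ∈ Ik k, ω k i * ‖subgradProj (f i) (g i) (x k) - x k‖ ^ 2 with hAd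
    set D := ‖x k - z‖ ^ 2 - ‖x (k + 1) - z‖ ^ 2 with hDd
    have hD1 : α k * (2 - α k) * A ≤ D := by
      have := mul_le_mul_of_nonneg_left hV (sq_nonneg (α k))
      rw [hDd]; linarith
    have hV0 : 0 ≤ V := sq_nonneg _
    have hA0 : 0 ≤ A := hV0.trans hV
    have hD2 : α k * (2 - αplus) * A ≤ D := by
      refine le_trans ?_ hD1
      gcongr
    have key : ∀ t : ℝ, ωminus * (2 - αplus) * αminus ^ 2 * t ≤ αplus * D → t ≤ K * D := by
      intro t ht
      rw [hKdef, div_mul_eq_mul_div, le_div_iff₀ (by positivity)]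
      linarith
    constructor
    · rw [e2, norm_smul, mul_pow, Real.norm_eq_abs, sq_abs, ← hVd]
      apply key
      have hc : ωminus * αminus ^ 2 ≤ 1 := by
        have : αminus ^ 2 ≤ 1 := pow_le_one₀ ham0.le ham1
        nlinarith [sq_nonneg αminus]
      calc ωminus * (2 - αplus) * αminus ^ 2 * (α k ^ 2 * V)
          = (ωminus * αminus ^ 2) * (α k * (α k * (2 - αplus) * V)) := by ring
        _ ≤ 1 * (αplus * (α k * (2 - αplus) * A)) := by gcongr
        _ ≤ αplus * D := by rw [one_mul]; gcongr
    · intro j hj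
      have hj1 : ωminus * ‖subgradProj (f j) (g j) (x k) - x k‖ ^ 2 ≤ A := by
        calc _ ≤ ω k j * ‖subgradProj (f j) (g j) (x k) - x k‖ ^ 2 := by
              gcongr; exact (hω k j hj).1
          _ ≤ A := Finset.single_le_sum
              (f := fun i => ω k i * ‖subgradProj (f i) (g i) (x k) - x k‖ ^ 2)
              (fun i hi => mul_nonneg (hwk i hi) (sq_nonneg _)) hj
      have hc : αminus ^ 2 ≤ α k := by nlinarith
      have hD0 : 0 ≤ D := le_trans (by positivity) hD2
      apply key
      calc ωminus * (2 - αplus) * αminus ^ 2 * ‖subgradProj (f j) (g j) (x k) - x k‖ ^ 2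
          = αminus ^ 2 * (2 - αplus) *
            (ωminus * ‖subgradProj (f j) (g j) (x k) - x k‖ ^ 2) := by ring
        _ ≤ α k * (2 - αplus) * A := by gcongr
        _ ≤ D := hD2
        _ ≤ αplus * D := by nlinarith
  have hF : ∀ z ∈ C, ∀ k, ‖x (k + 1) - z‖ ≤ ‖x k - z‖ := by
    intro z hz k
    have h1 := (sq_nonneg _).trans (hstep z hz k).1
    have h2 := nonneg_of_mul_nonneg_right h1 hK0
    exact (sq_le_sq₀ (norm_nonneg _) (norm_nonneg _)).mp (by linarith)
  have hanti : ∀ z ∈ C, Antitone fun k => ‖x k - z‖ := fun z hz => antitone_nat_of_succ_le (hF z hz)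
  have hball : ∀ k, x k ∈ closedBall x0p r := by
    intro k
    rw [mem_closedBall, dist_eq_norm, ← hx0pproj]
    exact hanti x0p hx0p (Nat.zero_le k)
  -- κ ≥ 1
  have hκ1 : 1 ≤ κ := by
    have h1 := hreg (x 0) (hball 0)
    have h2 : (Finset.univ.sup' Finset.univ_nonempty fun i =>
        infDist (x 0) {z : EuclideanSpace ℝ (Fin n) | f i z ≤ 0}) ≤ r := by
      refine Finset.sup'_le _ _ fun i _ => ?_
      exact infDist_le_infDist_of_subset (Set.iInter_subset _ i) hC
    have h3 : r ≤ κ * r := h1.trans (mul_le_mul_of_nonneg_left h2 hκ.le)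
    by_contra! h
    nlinarith
  set c : ℝ := ωminus * (2 - αplus) * αminus ^ 2 / ((s : ℝ) * αplus) * (δ / (Δ * κ)) ^ 2 with hc
  have hc0 : 0 < c := by positivity
  have hc1 : c < 1 := by
    have h1 : ωminus * (2 - αplus) * αminus ^ 2 / ((s : ℝ) * αplus) ≤ 1 := by
      rw [div_le_one (by positivity)]
      have a1 : αminus ^ 2 ≤ 1 := pow_le_one₀ ham0.le ham1
      calc ωminus * (2 - αplus) * αminus ^ 2 ≤ 1 * 1 * 1 := by gcongr; linarith
        _ ≤ s * αplus := by nlinarith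
    have h2 : δ / (Δ * κ) ≤ 1 / 2 := by
      rw [div_le_iff₀ (by positivity)]
      nlinarith
    have h3 : 0 < δ / (Δ * κ) := by positivity
    calc c ≤ 1 * (1 / 2) ^ 2 := by rw [hc]; gcongr
      _ < 1 := by norm_num
  set q : ℝ := (1 - c) ^ ((1 : ℝ) / (2 * (s : ℝ))) with hq
  have hq0 : 0 < q := Real.rpow_pos_of_pos (by linarith) _
  have hq1 : q < 1 := Real.rpow_lt_one (by linarith) (by linarith) (by positivity)
  have hqs : (q ^ s) ^ 2 = 1 - c := by
    rw [← pow_mul, hq, ← Real.rpow_natCast, ← Real.rpow_mul (by linarith)]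
    have : (1 : ℝ) / (2 * (s : ℝ)) * ((s * 2 : ℕ) : ℝ) = 1 := by
      push_cast; field_simp
    rw [this, Real.rpow_one]
  -- the block estimate
  have hblock : ∀ k, infDist (x (k + s)) C ≤ q ^ s * infDist (x k) C := by
    intro k
    obtain ⟨z, hz, hzd⟩ := hCclosed.exists_infDist_eq_dist hC (x k)
    rw [dist_eq_norm] at hzd
    obtain ⟨i, -, hi⟩ := Finset.exists_mem_eq_sup' Finset.univ_nonempty
      (fun i => infDist (x k) {z : EuclideanSpace ℝ (Fin n) | f i z ≤ 0})
    have h1 := hreg (x k) (hball k)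
    rw [hi] at h1
    obtain ⟨l, hl, hil⟩ := hcover k i
    obtain ⟨j, hj, hjmax⟩ := hiii (k + l)
    set b := ‖subgradProj (f j) (g j) (x (k + l)) - x (k + l)‖ with hb
    have hbl := aux_block x z K hK0.le k (fun k => (hstep z hz k).1) l b
      ((hstep z hz (k + l)).2 j hj)
    have h2 : δ * infDist (x (k + l)) {z | f i z ≤ 0} ≤ Δ * b :=
      (hbd _ (hball (k + l)) i).1.trans ((hjmax i hil).trans (hbd _ (hball (k + l)) j).2)
    have h3 : infDist (x k) {z | f i z ≤ 0} ≤
        infDist (x (k + l)) {z | f i z ≤ 0} + ‖x k - x (k + l)‖ := by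
      rw [← dist_eq_norm]; exact infDist_le_infDist_add_dist
    have h4 : δ * infDist (x k) C ≤ Δ * κ * (‖x k - x (k + l)‖ + b) := by
      calc δ * infDist (x k) C ≤ δ * (κ * (infDist (x (k + l)) {z | f i z ≤ 0} +
            ‖x k - x (k + l)‖)) := by
            apply mul_le_mul_of_nonneg_left _ hδ.le
            exact h1.trans (mul_le_mul_of_nonneg_left h3 hκ.le)
        _ = κ * (δ * infDist (x (k + l)) {z | f i z ≤ 0} + δ * ‖x k - x (k + l)‖) := by ring
        _ ≤ κ * (Δ * b + Δ * ‖x k - x (k + l)‖) := by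
            gcongr; linarith
        _ = _ := by ring
    have h5 : δ / (Δ * κ) * infDist (x k) C ≤ ‖x k - x (k + l)‖ + b := by
      rw [div_mul_eq_mul_div, div_le_iff₀ (by positivity)]
      linarith
    have h6 : infDist (x (k + s)) C ≤ ‖x (k + l + 1) - z‖ := by
      refine (infDist_le_dist_of_mem hz).trans ?_
      rw [dist_eq_norm]
      exact hanti z hz (by omega)
    set d := infDist (x k) C with hd
    set d' := infDist (x (k + s)) C with hd'
    have hd0 : 0 ≤ d := infDist_nonneg
    have hd0' : 0 ≤ d' := infDist_nonneg
    have hmono : ‖x (k + l + 1) - z‖ ≤ ‖x k - z‖ := hanti z hz (by omega)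
    have h7 : (δ / (Δ * κ) * d) ^ 2 ≤ s * K * (d ^ 2 - d' ^ 2) := by
      calc (δ / (Δ * κ) * d) ^ 2 ≤ (‖x k - x (k + l)‖ + b) ^ 2 := by gcongr
        _ ≤ _ := hbl
        _ ≤ s * K * (‖x k - z‖ ^ 2 - ‖x (k + l + 1) - z‖ ^ 2) := by
            have : (l + 1 : ℝ) ≤ s := by exact_mod_cast hl
            have h0 : 0 ≤ ‖x k - z‖ ^ 2 - ‖x (k + l + 1) - z‖ ^ 2 := by
              have : ‖x (k + l + 1) - z‖ ^ 2 ≤ ‖x k - z‖ ^ 2 := by gcongr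
              linarith
            gcongr
        _ ≤ _ := by rw [← hzd]; gcongr
    have h8 : c * d ^ 2 ≤ d ^ 2 - d' ^ 2 := by
      have hcK : c = (δ / (Δ * κ)) ^ 2 / (s * K) := by
        rw [hc, hKdef]; field_simp
      rw [hcK, div_mul_eq_mul_div, div_le_iff₀ (by positivity), ← mul_pow]
      linarith
    refine (sq_le_sq₀ hd0' (by positivity)).mp ?_
    rw [mul_pow, hqs]
    linarith
  obtain ⟨xinf, hxinf, hx1, hx2⟩ := aux_conv x C hC hCclosed hF q hq0 hq1 s hs hblock
  refine ⟨xinf, hxinf, hx2, fun k => ⟨?_, ?_⟩⟩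
  · have h1 := hreg (x k) (hball k)
    have h2 : δ * (Finset.univ.sup' Finset.univ_nonempty fun i =>
        infDist (x k) {z : EuclideanSpace ℝ (Fin n) | f i z ≤ 0}) ≤
        Finset.univ.sup' Finset.univ_nonempty fun i => max 0 (f i (x k)) := by
      obtain ⟨i, -, hi⟩ := Finset.exists_mem_eq_sup' Finset.univ_nonempty
        (fun i => infDist (x k) {z : EuclideanSpace ℝ (Fin n) | f i z ≤ 0})
      rw [hi]
      exact (hbd _ (hball k) i).1.trans
        (Finset.le_sup' (fun i => max 0 (f i (x k))) (Finset.mem_univ i))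
    refine le_trans ?_ h2
    rw [div_mul_eq_mul_div, div_le_iff₀ (by positivity)]
    have h3 := mul_le_mul_of_nonneg_left ((hx1 k).trans (mul_le_mul_of_nonneg_left h1 zero_le_two)) hδ.le
    linarith
  · refine Finset.sup'_le _ _ fun i _ => ?_
    refine (hbd _ (hball k) i).2.trans ?_
    rw [mul_assoc]
    apply mul_le_mul_of_nonneg_left _ hΔ0.le
    exact (aux_norm_le (f i) (g i) (hsub i) (x k) xinf ((hmemC xinf).mp hxinf i)).trans (hx2 k)
end
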